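/- arXiv:1803.06931 — 4 statements merged into one kernel-verified Lean document; each statement's English description precedes it below -/
import Mathlib

section
/- Leibniz formula for the Cauchy–Riemann operator (Lemma 3.1): Let f, g : ℝ³ → ℍ be functions that are differentiable at a point x, and write f = f₀e₀ + f₁e₁ + f₂e₂ + f₃e₃ with realvalued components f₀, f₁, f₂, f₃. Then at x one has D(fg) = (Df)·g − f̄·(D̄g) + 2·( f₀·∂g/∂x₀ − f₁·∂g/∂x₁ − f₂·∂g/∂x₂ ), where fg denotes the pointwise quaternion product. -/
open scoped Quaternion

noncomputable section

/-- Partial derivative of a quaternion-valued function in the `j`-th coordinate direction. -/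
def pd (j : Fin 3) (f : (Fin 3 → ℝ) → ℍ[ℝ]) (x : Fin 3 → ℝ) : ℍ[ℝ] :=
  fderiv ℝ f x (Pi.single j 1)

/-- The basis element `e₁ = i`. -/
def e1 : ℍ[ℝ] := ⟨0, 1, 0, 0⟩

/-- The basis element `e₂ = j`. -/
def e2 : ℍ[ℝ] := ⟨0, 0, 1, 0⟩

/-- The Cauchy–Riemann operator `D f = ∂₀ f + e₁ ∂₁ f + e₂ ∂₂ f`. -/
def CR (f : (Fin 3 → ℝ) → ℍ[ℝ]) (x : Fin 3 → ℝ) : ℍ[ℝ] :=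
  pd 0 f x + e1 * pd 1 f x + e2 * pd 2 f x

/-- The conjugate Cauchy–Riemann operator `D̄ f = ∂₀ f - e₁ ∂₁ f - e₂ ∂₂ f`. -/
def CRbar (f : (Fin 3 → ℝ) → ℍ[ℝ]) (x : Fin 3 → ℝ) : ℍ[ℝ] :=
  pd 0 f x - e1 * pd 1 f x - e2 * pd 2 f x

@[simp] theorem e1_re : e1.re = 0 := rfl

@[simp] theorem e1_imI : e1.imI = 1 := rfl

@[simp] theorem e1_imJ : e1.imJ = 0 := rfl

@[simp] theorem e1_imK : e1.imK = 0 := rfl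

@[simp] theorem e2_re : e2.re = 0 := rfl

@[simp] theorem e2_imI : e2.imI = 0 := rfl

@[simp] theorem e2_imJ : e2.imJ = 1 := rfl

@[simp] theorem e2_imK : e2.imK = 0 := rfl

/-- The product rule for partial derivatives of quaternion-valued functions. -/
theorem pd_mul (j : Fin 3) {f g : (Fin 3 → ℝ) → ℍ[ℝ]} {x : Fin 3 → ℝ}
    (hf : DifferentiableAt ℝ f x) (hg : DifferentiableAt ℝ g x) :
    pd j (fun y => f y * g y) x = f x * pd j g x + pd j f x * g x := by
  simp [pd, fderiv_fun_mul' hf hg]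

/-- Leibniz formula for the Cauchy–Riemann operator (Lemma 3.1):
`D(fg) = (Df)g − f̄(D̄g) + 2 Sc(fD)g`, where
`Sc(fD)g = f₀ ∂₀g − f₁ ∂₁g − f₂ ∂₂g`. -/
theorem leibniz_formula (f g : (Fin 3 → ℝ) → ℍ[ℝ]) (x : Fin 3 → ℝ)
    (hf : DifferentiableAt ℝ f x) (hg : DifferentiableAt ℝ g x) :
    CR (fun y => f y * g y) x =
      CR f x * g x - star (f x) * CRbar g x +
        (2 : ℝ) • ((f x).re • pd 0 g x - (f x).imI • pd 1 g x - (f x).imJ • pd 2 g x) := by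
  rw [CR, pd_mul 0 hf hg, pd_mul 1 hf hg, pd_mul 2 hf hg, CR, CRbar]
  ext <;> simp <;> ring
end
end

section
/- Pointwise Alessandrini integrand identity (key computation in Proposition 2.2): Let σ₁, σ₂ : U → ℝ be positive functions on an open set U ⊆ ℝ³ and μⱼ = (1 − σⱼ)/(1 + σⱼ) for j = 1,2. For j = 1,2, let uⱼ, u₀ⱼ, u₁ⱼ, u₂ⱼ be real-valued functions differentiable on U with curl(u₀ⱼ,u₁ⱼ,u₂ⱼ) = σⱼ·∇uⱼ and div(u₀ⱼ,u₁ⱼ,u₂ⱼ) = 0 on U, and let Fⱼ = uⱼ·e₀ + u₂ⱼ·e₁ − u₁ⱼ·e₂ − u₀ⱼ·e₃. Then at every point of U: (σ₂ − σ₁)·(∇u₁ · ∇u₂) = ((μ₁ − μ₂)/2)·⟨D F̄₂, D F̄₁⟩, where ⟨A,B⟩ denotes the scalar (e₀-) part of Ā·B, i.e. the Euclidean inner product of A and B viewed as vectors in ℝ⁴. -/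
open scoped Quaternion

noncomputable section

/-- Partial derivative of a real-valued function in the `j`-th coordinate direction. -/
def pdR (j : Fin 3) (u : (Fin 3 → ℝ) → ℝ) (x : Fin 3 → ℝ) : ℝ :=
  fderiv ℝ u x (Pi.single j 1)

/-- `F = u e₀ + u₂ e₁ − u₁ e₂ − u₀ e₃`. -/
def Fq (u u₀ u₁ u₂ : (Fin 3 → ℝ) → ℝ) : (Fin 3 → ℝ) → ℍ[ℝ] :=
  fun y => ⟨u y, u₂ y, -u₁ y, -u₀ y⟩


/-- The Euclidean inner product on `ℍ`, i.e. the scalar (`e₀`-) part of `Ā B`. -/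
def qInner (A B : ℍ[ℝ]) : ℝ := (star A * B).re

/-- The quaternion with the given coordinates, as an element of `ℍ[ℝ]`. -/
def quat (a b c d : ℝ) : ℍ[ℝ] := ⟨a, b, c, d⟩

@[simp] theorem re_quat (a b c d : ℝ) : (quat a b c d).re = a := rfl

@[simp] theorem imI_quat (a b c d : ℝ) : (quat a b c d).imI = b := rfl

@[simp] theorem imJ_quat (a b c d : ℝ) : (quat a b c d).imJ = c := rfl

@[simp] theorem imK_quat (a b c d : ℝ) : (quat a b c d).imK = d := rfl

theorem e1_eq_quat : e1 = quat 0 1 0 0 := rfl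

theorem e2_eq_quat : e2 = quat 0 0 1 0 := rfl

theorem Fq_eq_quat (u u₀ u₁ u₂ : (Fin 3 → ℝ) → ℝ) (y : Fin 3 → ℝ) :
    Fq u u₀ u₁ u₂ y = quat (u y) (u₂ y) (-u₁ y) (-u₀ y) := rfl

/-- The partial derivatives of a quaternion-valued function are computed componentwise. -/
theorem pd_quat {a b c d : (Fin 3 → ℝ) → ℝ} {x : Fin 3 → ℝ} (ha : DifferentiableAt ℝ a x)
    (hb : DifferentiableAt ℝ b x) (hc : DifferentiableAt ℝ c x) (hd : DifferentiableAt ℝ d x)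
    (j : Fin 3) :
    pd j (fun y => quat (a y) (b y) (c y) (d y)) x =
      quat (pdR j a x) (pdR j b x) (pdR j c x) (pdR j d x) := by
  have key : (fun y => quat (a y) (b y) (c y) (d y)) = fun y =>
      a y • quat 1 0 0 0 + b y • quat 0 1 0 0 +
        c y • quat 0 0 1 0 + d y • quat 0 0 0 1 := by
    funext y
    ext <;> simp
  have h := (((ha.hasFDerivAt.smul_const (quat 1 0 0 0)).fun_add
    (hb.hasFDerivAt.smul_const (quat 0 1 0 0))).fun_add
    (hc.hasFDerivAt.smul_const (quat 0 0 1 0))).fun_add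
    (hd.hasFDerivAt.smul_const (quat 0 0 0 1))
  rw [pd, key, h.fderiv]
  ext <;> simp [pdR]

theorem pdR_neg (j : Fin 3) (u : (Fin 3 → ℝ) → ℝ) (x : Fin 3 → ℝ) :
    pdR j (fun y => -u y) x = -pdR j u x := by
  simp [pdR]

/-- The Cauchy–Riemann operator applied to the conjugate of `F`: the gradient of `u` plus the
curl of `(u₀, u₁, u₂)`, with the divergence of `(u₀, u₁, u₂)` as the last component. -/
theorem CR_star_Fq {u u₀ u₁ u₂ : (Fin 3 → ℝ) → ℝ} {x : Fin 3 → ℝ}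
    (h : DifferentiableAt ℝ u x) (h₀ : DifferentiableAt ℝ u₀ x)
    (h₁ : DifferentiableAt ℝ u₁ x) (h₂ : DifferentiableAt ℝ u₂ x) :
    CR (fun y => star (Fq u u₀ u₁ u₂ y)) x =
      quat (pdR 0 u x + (pdR 1 u₂ x - pdR 2 u₁ x)) (pdR 1 u x + (pdR 2 u₀ x - pdR 0 u₂ x))
        (pdR 2 u x + (pdR 0 u₁ x - pdR 1 u₀ x)) (pdR 0 u₀ x + pdR 1 u₁ x + pdR 2 u₂ x) := by
  have key : (fun y => star (Fq u u₀ u₁ u₂ y)) =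
      fun y => quat (u y) (-u₂ y) (u₁ y) (u₀ y) := by
    funext y
    ext <;> simp [Fq_eq_quat]
  simp only [key, CR, pd_quat h h₂.fun_neg h₁ h₀, pdR_neg]
  ext <;> simp [e1_eq_quat, e2_eq_quat] <;> ring

/-- Pointwise Alessandrini integrand identity (key computation in Proposition 2.2):
if `curl(u₀ⱼ,u₁ⱼ,u₂ⱼ) = σⱼ ∇uⱼ` and `div(u₀ⱼ,u₁ⱼ,u₂ⱼ) = 0` on `U` for `j = 1,2`, then
`(σ₂ − σ₁) ∇u₁·∇u₂ = ((μ₁ − μ₂)/2) ⟨D F̄₂, D F̄₁⟩` at every point of `U`,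
where `μⱼ = (1 − σⱼ)/(1 + σⱼ)`. -/
theorem alessandrini_integrand (U : Set (Fin 3 → ℝ)) (hU : IsOpen U)
    (σ₁ σ₂ : (Fin 3 → ℝ) → ℝ)
    (hσ₁ : ∀ x ∈ U, 0 < σ₁ x) (hσ₂ : ∀ x ∈ U, 0 < σ₂ x)
    (v₁ v₀₁ v₁₁ v₂₁ v₂ v₀₂ v₁₂ v₂₂ : (Fin 3 → ℝ) → ℝ)
    (h₁ : DifferentiableOn ℝ v₁ U) (h₀₁ : DifferentiableOn ℝ v₀₁ U)
    (h₁₁ : DifferentiableOn ℝ v₁₁ U) (h₂₁ : DifferentiableOn ℝ v₂₁ U)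
    (h₂ : DifferentiableOn ℝ v₂ U) (h₀₂ : DifferentiableOn ℝ v₀₂ U)
    (h₁₂ : DifferentiableOn ℝ v₁₂ U) (h₂₂ : DifferentiableOn ℝ v₂₂ U)
    (hcurl₁ : ∀ x ∈ U,
      pdR 1 v₂₁ x - pdR 2 v₁₁ x = σ₁ x * pdR 0 v₁ x ∧
      pdR 2 v₀₁ x - pdR 0 v₂₁ x = σ₁ x * pdR 1 v₁ x ∧
      pdR 0 v₁₁ x - pdR 1 v₀₁ x = σ₁ x * pdR 2 v₁ x)
    (hdiv₁ : ∀ x ∈ U, pdR 0 v₀₁ x + pdR 1 v₁₁ x + pdR 2 v₂₁ x = 0)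
    (hcurl₂ : ∀ x ∈ U,
      pdR 1 v₂₂ x - pdR 2 v₁₂ x = σ₂ x * pdR 0 v₂ x ∧
      pdR 2 v₀₂ x - pdR 0 v₂₂ x = σ₂ x * pdR 1 v₂ x ∧
      pdR 0 v₁₂ x - pdR 1 v₀₂ x = σ₂ x * pdR 2 v₂ x)
    (hdiv₂ : ∀ x ∈ U, pdR 0 v₀₂ x + pdR 1 v₁₂ x + pdR 2 v₂₂ x = 0) :
    ∀ x ∈ U,
      (σ₂ x - σ₁ x) * ∑ j : Fin 3, pdR j v₁ x * pdR j v₂ x =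
        (((1 - σ₁ x) / (1 + σ₁ x) - (1 - σ₂ x) / (1 + σ₂ x)) / 2) *
          qInner (CR (fun y => star (Fq v₂ v₀₂ v₁₂ v₂₂ y)) x)
                 (CR (fun y => star (Fq v₁ v₀₁ v₁₁ v₂₁ y)) x) := by
  intro x hx
  have hn := hU.mem_nhds hx
  obtain ⟨a₀, a₁, a₂⟩ := hcurl₁ x hx
  obtain ⟨b₀, b₁, b₂⟩ := hcurl₂ x hx
  rw [CR_star_Fq (h₁.differentiableAt hn) (h₀₁.differentiableAt hn) (h₁₁.differentiableAt hn)
      (h₂₁.differentiableAt hn), CR_star_Fq (h₂.differentiableAt hn) (h₀₂.differentiableAt hn)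
      (h₁₂.differentiableAt hn) (h₂₂.differentiableAt hn),
    a₀, a₁, a₂, b₀, b₁, b₂, hdiv₁ x hx, hdiv₂ x hx]
  have hs₁ : 1 + σ₁ x ≠ 0 := by linarith [hσ₁ x hx]
  have hs₂ : 1 + σ₂ x ≠ 0 := by linarith [hσ₂ x hx]
  simp only [qInner, Fin.sum_univ_three, Quaternion.re_mul, Quaternion.re_star,
    Quaternion.imI_star, Quaternion.imJ_star, Quaternion.imK_star, re_quat, imI_quat,
    imJ_quat, imK_quat]
  field_simp
  ring
end
end

section
/- Existence of CGO parameters (construction in the proof of Proposition 2.3): for every k = (k₀,k₁,k₂) ∈ ℝ³ there exist a = (a₁,a₂), b = (b₁,b₂) ∈ ℂ² and w_a, w_b ∈ ℂ such that w_a² = a₁² + a₂², w_b² = b₁² + b₂², a₁ + b₁ = k₁, a₂ + b₂ = k₂, w_a + w_b = i·k₀, and w_a·w_b − (a₁b₁ + a₂b₂) = −‖k‖²/2, where ‖k‖² = k₀² + k₁² + k₂². (Explicitly, when (k₁,k₂) ≠ (0,0) one may take b = (λ, iλ) with λ = ‖k‖²/(2(k₁ + i·k₂)) and a = (k₁,k₂)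 − b, with the square roots chosen so that w_a + w_b = i·k₀; when (k₁,k₂) = (0,0) one may take a = −b = (0, i·k₀/2).) -/
/-- Existence of CGO parameters (construction in the proof of Proposition 2.3):
for every `k = (k₀,k₁,k₂) ∈ ℝ³` there are `a, b ∈ ℂ²` and square roots `w_a, w_b` of
`|a|_ℂ²`, `|b|_ℂ²` with `a + b = (k₁,k₂)`, `w_a + w_b = i k₀` and
`w_a w_b − a·b = −‖k‖²/2`. -/
theorem exists_cgo_parameters (k₀ k₁ k₂ : ℝ) :
    ∃ (a₁ a₂ b₁ b₂ wa wb : ℂ),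
      wa ^ 2 = a₁ ^ 2 + a₂ ^ 2 ∧
      wb ^ 2 = b₁ ^ 2 + b₂ ^ 2 ∧
      a₁ + b₁ = (k₁ : ℂ) ∧
      a₂ + b₂ = (k₂ : ℂ) ∧
      wa + wb = Complex.I * (k₀ : ℂ) ∧
      wa * wb - (a₁ * b₁ + a₂ * b₂) = -((k₀ ^ 2 + k₁ ^ 2 + k₂ ^ 2 : ℝ) : ℂ) / 2 := by
  have hI : Complex.I ^ 2 = -1 := Complex.I_sq
  push_cast
  by_cases hz : (k₁ : ℂ) + Complex.I * k₂ = 0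
  · have h₁ : k₁ = 0 := by simpa using congrArg Complex.re hz
    have h₂ : k₂ = 0 := by simpa using congrArg Complex.im hz
    subst h₁ h₂
    refine ⟨0, Complex.I * k₀ / 2, 0, -(Complex.I * k₀ / 2), Complex.I * k₀ / 2,
      Complex.I * k₀ / 2, by ring, by ring, by simp, by simp, by ring, ?_⟩
    push_cast
    linear_combination (k₀ : ℂ) ^ 2 / 2 * hI
  · obtain ⟨c, hc⟩ : ∃ c : ℂ,
        c * (k₁ + Complex.I * k₂) = ((k₀ : ℂ) ^ 2 + k₁ ^ 2 + k₂ ^ 2) / 2 :=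
      ⟨_, div_mul_cancel₀ _ hz⟩
    refine ⟨k₁ - c, k₂ - Complex.I * c, c, Complex.I * c, Complex.I * k₀, 0,
      ?_, ?_, by ring, by ring, by ring, ?_⟩
    · linear_combination ((k₀ : ℂ) ^ 2 - c ^ 2) * hI + 2 * hc
    · linear_combination -c ^ 2 * hI
    · linear_combination c ^ 2 * hI - hc
end

section
/- Injectivity of the linearized Calderón problem at a constant conductivity (Proposition 2.3, reformulated via Calderón's reduction): Let B ⊂ ℝ³ be the open unit ball and let δ : ℝ³ → ℝ be a bounded measurable function. Suppose that for all entire harmonic functions u₁, u₂ : ℝ³ → ℂ one has ∫_B δ(x)·(∇u₁(x)·∇u₂(x)) dx = 0 (Lebesgue integral). Then δ = 0 almost everywhere in B. -/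
open MeasureTheory

noncomputable section

/-- Partial derivative of a complex-valued function on `ℝ³` in the `j`-th direction. -/
def pdC (j : Fin 3) (u : EuclideanSpace ℝ (Fin 3) → ℂ) (x : EuclideanSpace ℝ (Fin 3)) : ℂ :=
  fderiv ℝ u x (EuclideanSpace.single j 1)

/-- A function `u : ℝ³ → ℂ` is entire harmonic if it is smooth and `Δu = 0` everywhere. -/
def EntireHarmonic (u : EuclideanSpace ℝ (Fin 3) → ℂ) : Prop :=
  ContDiff ℝ (⊤ : ℕ∞) u ∧ ∀ x, ∑ j : Fin 3, pdC j (fun y => pdC j u y) x = 0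

/-- The exponential `x ↦ exp (ζ · x)` with complex frequency `ζ`. -/
def complexExponential (ζ : Fin 3 → ℂ) (x : EuclideanSpace ℝ (Fin 3)) : ℂ :=
  Complex.exp (∑ j, ζ j * (x j : ℂ))

theorem contDiff_complexExponential (ζ : Fin 3 → ℂ) :
    ContDiff ℝ (⊤ : ℕ∞) (complexExponential ζ) := by
  unfold complexExponential
  refine ContDiff.cexp (ContDiff.sum fun j _ => contDiff_const.mul ?_)
  exact Complex.ofRealCLM.contDiff.comp (EuclideanSpace.proj (𝕜 := ℝ) j).contDiff

theorem pdC_const_mul {u : EuclideanSpace ℝ (Fin 3) → ℂ} (hu : Differentiable ℝ u) (c : ℂ)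
    (j : Fin 3) : pdC j (fun x => c * u x) = fun x => c * pdC j u x := by
  funext x
  simp [pdC, fderiv_const_mul (hu x)]

theorem pdC_complexExponential (ζ : Fin 3 → ℂ) (j : Fin 3) :
    pdC j (complexExponential ζ) = fun x => ζ j * complexExponential ζ x := by
  funext x
  have hlin : HasFDerivAt (fun y : EuclideanSpace ℝ (Fin 3) => ∑ k, ζ k * (y k : ℂ))
      (∑ k, ζ k • (Complex.ofRealCLM.comp (EuclideanSpace.proj (𝕜 := ℝ) k))) x := by
    refine HasFDerivAt.fun_sum fun k _ => ?_
    exact (Complex.ofRealCLM.comp (EuclideanSpace.proj (𝕜 := ℝ) k)).hasFDerivAt.const_mul (ζ k)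
  have hexp : HasFDerivAt (complexExponential ζ) _ x := hlin.cexp
  rw [pdC, hexp.fderiv]
  simp [complexExponential, mul_comm]
  simp [apply_ite]

theorem entireHarmonic_complexExponential {ζ : Fin 3 → ℂ} (hζ : ∑ j, ζ j * ζ j = 0) :
    EntireHarmonic (complexExponential ζ) := by
  refine ⟨contDiff_complexExponential ζ, fun x => ?_⟩
  have hd : Differentiable ℝ (complexExponential ζ) :=
    (contDiff_complexExponential ζ).differentiable (by simp)
  calc ∑ j, pdC j (fun y => pdC j (complexExponential ζ) y) x
      = (∑ j, ζ j * ζ j) * complexExponential ζ x := by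
        rw [Finset.sum_mul]
        refine Finset.sum_congr rfl fun j _ => ?_
        simp only [pdC_complexExponential, pdC_const_mul hd]
        ring
    _ = 0 := by rw [hζ, zero_mul]

/-- Every vector of `ℝ³` has an orthogonal vector of the same length. -/
theorem exists_orthogonal_same_length (a : Fin 3 → ℝ) :
    ∃ b : Fin 3 → ℝ, ∑ j, a j * b j = 0 ∧ ∑ j, b j * b j = ∑ j, a j * a j := by
  by_cases h : a 0 ^ 2 + a 1 ^ 2 = 0
  · have h₀ : a 0 = 0 := by nlinarith [sq_nonneg (a 0), sq_nonneg (a 1)]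
    have h₁ : a 1 = 0 := by nlinarith [sq_nonneg (a 0), sq_nonneg (a 1)]
    exact ⟨![a 2, 0, 0], by simp [Fin.sum_univ_three, h₀], by simp [Fin.sum_univ_three, h₀, h₁]⟩
  · have hr : √((∑ j, a j * a j) / (a 0 ^ 2 + a 1 ^ 2)) ^ 2
        = (∑ j, a j * a j) / (a 0 ^ 2 + a 1 ^ 2) :=
      Real.sq_sqrt (div_nonneg (Finset.sum_nonneg fun j _ => mul_self_nonneg _) (by positivity))
    set r := √((∑ j, a j * a j) / (a 0 ^ 2 + a 1 ^ 2))
    refine ⟨![-(r * a 1), r * a 0, 0], ?_, ?_⟩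
    · simp [Fin.sum_univ_three]
      ring
    · rw [eq_div_iff h] at hr
      rw [← hr]
      simp [Fin.sum_univ_three]
      ring

/-- Calderón's choice of harmonic exponentials turns the orthogonality relation into the vanishing
of the Fourier transform at every nonzero frequency. -/
theorem integral_mul_exp_eq_zero {δ : EuclideanSpace ℝ (Fin 3) → ℝ}
    {s : Set (EuclideanSpace ℝ (Fin 3))}
    (h : ∀ u₁ u₂ : EuclideanSpace ℝ (Fin 3) → ℂ, EntireHarmonic u₁ → EntireHarmonic u₂ →
      ∫ x in s, (δ x : ℂ) * ∑ j : Fin 3, pdC j u₁ x * pdC j u₂ x = 0)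
    {t : EuclideanSpace ℝ (Fin 3)} (ht : t ≠ 0) :
    ∫ x in s, (δ x : ℂ) * Complex.exp (inner ℝ x t * Complex.I) = 0 := by
  obtain ⟨b, hab, hbb⟩ := exists_orthogonal_same_length t
  have hab' : ∑ j, (t j : ℂ) * b j = 0 := by exact_mod_cast hab
  have hbb' : ∑ j, (b j : ℂ) * b j = ∑ j, (t j : ℂ) * t j := by exact_mod_cast hbb
  have htt : ∑ j, (t j : ℂ) * t j ≠ 0 := by
    have : ∑ j, t j * t j ≠ 0 := by
      intro h0
      refine ht (PiLp.ext fun j => ?_)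
      simpa using (Finset.sum_eq_zero_iff_of_nonneg fun j _ => mul_self_nonneg (t j)).1 h0 j
    exact_mod_cast this
  simp only [Fin.sum_univ_three] at hab' hbb' htt
  let ζ₁ : Fin 3 → ℂ := fun j => (b j + t j * Complex.I) / 2
  let ζ₂ : Fin 3 → ℂ := fun j => (-b j + t j * Complex.I) / 2
  have h₁ : ∑ j, ζ₁ j * ζ₁ j = 0 := by
    simp only [Fin.sum_univ_three, ζ₁]
    linear_combination hbb' / 4 + Complex.I / 2 * hab' +
      (t 0 * t 0 + t 1 * t 1 + t 2 * t 2 : ℂ) / 4 * Complex.I_sq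
  have h₂ : ∑ j, ζ₂ j * ζ₂ j = 0 := by
    simp only [Fin.sum_univ_three, ζ₂]
    linear_combination hbb' / 4 - Complex.I / 2 * hab' +
      (t 0 * t 0 + t 1 * t 1 + t 2 * t 2 : ℂ) / 4 * Complex.I_sq
  have h₁₂ : ∑ j, ζ₁ j * ζ₂ j = -(t 0 * t 0 + t 1 * t 1 + t 2 * t 2 : ℂ) / 2 := by
    simp only [Fin.sum_univ_three, ζ₁, ζ₂]
    linear_combination -hbb' / 4 +
      (t 0 * t 0 + t 1 * t 1 + t 2 * t 2 : ℂ) / 4 * Complex.I_sq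
  have key := h _ _ (entireHarmonic_complexExponential h₁) (entireHarmonic_complexExponential h₂)
  have heq : ∀ x : EuclideanSpace ℝ (Fin 3),
      (δ x : ℂ) * ∑ j, pdC j (complexExponential ζ₁) x * pdC j (complexExponential ζ₂) x
        = (∑ j, ζ₁ j * ζ₂ j) * ((δ x : ℂ) * Complex.exp (inner ℝ x t * Complex.I)) := by
    intro x
    have hexp : complexExponential ζ₁ x * complexExponential ζ₂ x
        = Complex.exp (inner ℝ x t * Complex.I) := by
      rw [complexExponential, complexExponential, ← Complex.exp_add]
      congr 1
      simp [Fin.sum_univ_three, PiLp.inner_apply, ζ₁, ζ₂]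
      ring
    simp only [pdC_complexExponential, ← hexp, Fin.sum_univ_three]
    ring
  simp only [heq] at key
  rw [integral_const_mul, h₁₂] at key
  refine (mul_eq_zero.1 key).resolve_left ?_
  exact div_ne_zero (neg_ne_zero.2 htt) two_ne_zero

/-- An integrable real function whose Fourier transform vanishes off the origin is zero a.e. -/
theorem ae_eq_zero_of_integral_mul_exp_eq_zero {E : Type*} [NormedAddCommGroup E]
    [InnerProductSpace ℝ E] [FiniteDimensional ℝ E] [Nontrivial E] [MeasurableSpace E]
    [BorelSpace E] {μ : Measure E} {f : E → ℝ} (hmeas : Measurable f) (hf : Integrable f μ)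
    (h : ∀ t : E, t ≠ 0 → ∫ x, (f x : ℂ) * Complex.exp (inner ℝ x t * Complex.I) ∂μ = 0) :
    f =ᵐ[μ] 0 := by
  have hpos : Measurable fun x => ENNReal.ofReal (f x) := hmeas.ennreal_ofReal
  have hneg : Measurable fun x => ENNReal.ofReal (-f x) := hmeas.neg.ennreal_ofReal
  have hpos_fin : ∫⁻ x, ENNReal.ofReal (f x) ∂μ ≠ ⊤ := hf.lintegral_lt_top.ne
  have hneg_fin : ∫⁻ x, ENNReal.ofReal (-f x) ∂μ ≠ ⊤ := hf.neg.lintegral_lt_top.ne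
  have := isFiniteMeasure_withDensity hpos_fin
  have := isFiniteMeasure_withDensity hneg_fin
  have hchar : charFun (μ.withDensity fun x => ENNReal.ofReal (f x))
      = charFun (μ.withDensity fun x => ENNReal.ofReal (-f x)) := by
    refine Continuous.ext_on (dense_compl_singleton (0 : E)) continuous_charFun
      continuous_charFun fun t ht => ?_
    have hint : ∀ g : E → ℝ, Integrable g μ →
        Integrable (fun x => (g x : ℂ) * Complex.exp (inner ℝ x t * Complex.I)) μ := by
      intro g hg
      refine hg.ofReal.mul_bdd (c := 1) (by fun_prop) (.of_forall fun x => ?_)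
      rw [Complex.norm_exp_ofReal_mul_I]
    rw [charFun_apply, charFun_apply,
      integral_withDensity_eq_integral_toReal_smul hpos (.of_forall fun _ => ENNReal.ofReal_lt_top),
      integral_withDensity_eq_integral_toReal_smul hneg (.of_forall fun _ => ENNReal.ofReal_lt_top),
      ← sub_eq_zero]
    simp only [ENNReal.toReal_ofReal', Complex.real_smul]
    rw [← integral_sub (hint _ hf.pos_part) (hint _ hf.neg_part), ← h t ht]
    refine integral_congr_ae (.of_forall fun x => ?_)
    simp only [← sub_mul, ← Complex.ofReal_sub]
    rw [max_zero_sub_max_neg_zero_eq_self]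
  have hdens := (withDensity_eq_iff hpos.aemeasurable hneg.aemeasurable hpos_fin).1
    (Measure.ext_of_charFun hchar)
  filter_upwards [hdens] with x hx
  rcases le_total (f x) 0 with h0 | h0
  · rw [ENNReal.ofReal_of_nonpos h0, eq_comm, ENNReal.ofReal_eq_zero] at hx
    exact le_antisymm h0 (neg_nonpos.1 hx)
  · rw [ENNReal.ofReal_of_nonpos (neg_nonpos.2 h0), ENNReal.ofReal_eq_zero] at hx
    exact le_antisymm hx h0

/-- Injectivity of the linearized Calderón problem at a constant conductivity
(Proposition 2.3): if `δ` is bounded measurable and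
`∫_B δ ∇u₁·∇u₂ = 0` for all entire harmonic `u₁, u₂ : ℝ³ → ℂ`, then `δ = 0` a.e. in the
unit ball `B`. -/
theorem linearized_calderon_injective
    (δ : EuclideanSpace ℝ (Fin 3) → ℝ) (hmeas : Measurable δ)
    (hbd : ∃ C : ℝ, ∀ x, |δ x| ≤ C)
    (h : ∀ u₁ u₂ : EuclideanSpace ℝ (Fin 3) → ℂ, EntireHarmonic u₁ → EntireHarmonic u₂ →
      ∫ x in Metric.ball (0 : EuclideanSpace ℝ (Fin 3)) 1,
        (δ x : ℂ) * ∑ j : Fin 3, pdC j u₁ x * pdC j u₂ x = 0) :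
    ∀ᵐ x ∂(volume.restrict (Metric.ball (0 : EuclideanSpace ℝ (Fin 3)) 1)), δ x = 0 := by
  obtain ⟨C, hC⟩ := hbd
  have : IsFiniteMeasure (volume.restrict (Metric.ball (0 : EuclideanSpace ℝ (Fin 3)) 1)) :=
    ⟨by simp⟩
  exact ae_eq_zero_of_integral_mul_exp_eq_zero hmeas
    (.of_bound hmeas.aestronglyMeasurable C (.of_forall hC))
    fun t ht => integral_mul_exp_eq_zero h ht
end
end
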